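/- Let G be a finite connected simple graph of order at least 3 with exactly two blocks. If G has diameter 2, then G is 2-bootstrap good; moreover, letting v be the cut vertex of G and B₁, B₂ the two blocks, any pair of vertices with one vertex in B₁ − v and the other in B₂ − v percolates in G. -/

import Mathlib

open SimpleGraph

variable {V : Type*}

/-- One round of `r`-bootstrap percolation: a vertex becomes infected if it has
at least `r` infected neighbors. -/
def percStep (G : SimpleGraph V) (r : ℕ) (A : Set V) : Set V :=
  A ∪ {v | r ≤ (G.neighborSet v ∩ A).ncard}

/-- The infected set `A_t` after `t` rounds of spreading from `A₀ = A`. -/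
def percIter (G : SimpleGraph V) (r : ℕ) (A : Set V) : ℕ → Set V
  | 0 => A
  | t + 1 => percStep G r (percIter G r A t)

/-- `A` percolates: eventually every vertex is infected. -/
def Percolates (G : SimpleGraph V) (r : ℕ) (A : Set V) : Prop :=
  ∃ t, percIter G r A t = Set.univ

/-- `A` percolates in exactly `k` rounds, counting the initial round as round 1:
`k` is the least positive integer with `A_{k-1} = V(G)`. -/
def PercolatesIn (G : SimpleGraph V) (r : ℕ) (A : Set V) (k : ℕ) : Prop :=
  0 < k ∧ percIter G r A (k - 1) = Set.univ ∧ ∀ j < k - 1, percIter G r A j ≠ Set.univ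

/-- `G` is `r`-bootstrap good: some set of exactly `r` vertices percolates. -/
def BootstrapGood (G : SimpleGraph V) (r : ℕ) : Prop :=
  ∃ A : Set V, A.ncard = r ∧ Percolates G r A

/-- `B` induces a connected subgraph of `G` having no cut vertex of its own:
removing any vertex of `B` leaves all remaining pairs reachable. -/
def BlockPred (G : SimpleGraph V) (B : Set V) : Prop :=
  (G.induce B).Connected ∧
    ∀ v ∈ B, ∀ a b : ↥(B \ {v}), (G.induce (B \ {v})).Reachable a b

/-- A block of `G`: a maximal connected induced subgraph without a cut vertex. -/
def IsBlock (G : SimpleGraph V) (B : Set V) : Prop :=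
  BlockPred G B ∧ ∀ B' : Set V, B ⊆ B' → BlockPred G B' → B' = B

/-- `v` is a cut vertex: its deletion disconnects the graph. -/
def IsCutVertex (G : SimpleGraph V) (v : V) : Prop :=
  ¬ (G.induce {u | u ≠ v}).Connected

lemma BlockPred.reach {V : Type*} {G : SimpleGraph V} {C : Set V} (h : BlockPred G C) (v : V)
    (a b : ↥(C \ {v})) : (G.induce (C \ {v})).Reachable a b := by
  by_cases hv : v ∈ C
  · exact h.2 v hv a b
  · have h1 : C ⊆ C \ {v} := fun x hx => ⟨hx, fun hxv => hv (by
      rw [Set.mem_singleton_iff] at hxv; exact hxv ▸ hx)⟩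
    have := (h.1.preconnected ⟨a, a.2.1⟩ ⟨b, b.2.1⟩).map (G.induceHomOfLE h1).toHom
    exact this

lemma BlockPred.union {V : Type*} {G : SimpleGraph V} {C D : Set V} (hC : BlockPred G C)
    (hD : BlockPred G D) {p q : V} (hpq : p ≠ q) (hp : p ∈ C ∩ D) (hq : q ∈ C ∩ D) :
    BlockPred G (C ∪ D) := by
  refine ⟨induce_union_connected hC.1.preconnected hD.1.preconnected ⟨p, hp⟩, ?_⟩
  intro v _
  obtain ⟨r, hr, hrv⟩ : ∃ r, r ∈ C ∩ D ∧ r ≠ v := by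
    by_cases h : p = v
    · exact ⟨q, hq, fun h' => hpq (h.trans h'.symm)⟩
    · exact ⟨p, hp, h⟩
  have hCs : C \ {v} ⊆ (C ∪ D) \ {v} := fun x hx => ⟨Or.inl hx.1, hx.2⟩
  have hDs : D \ {v} ⊆ (C ∪ D) \ {v} := fun x hx => ⟨Or.inr hx.1, hx.2⟩
  have key : ∀ a : ↥((C ∪ D) \ {v}),
      (G.induce ((C ∪ D) \ {v})).Reachable a ⟨r, Or.inl hr.1, hrv⟩ := by
    rintro ⟨a, ha | ha, hav⟩
    · exact (hC.reach v ⟨a, ha, hav⟩ ⟨r, hr.1, hrv⟩).map (G.induceHomOfLE hCs).toHom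
    · exact (hD.reach v ⟨a, ha, hav⟩ ⟨r, hr.2, hrv⟩).map (G.induceHomOfLE hDs).toHom
  exact fun a b => (key a).trans (key b).symm

lemma blockPred_edge {V : Type*} {G : SimpleGraph V} {a b : V} (h : G.Adj a b) :
    BlockPred G {a, b} := by
  refine ⟨induce_pair_connected_of_adj h, ?_⟩
  rintro v hv ⟨x, hx, hxv⟩ ⟨y, hy, hyv⟩
  have : x = y := by
    simp only [Set.mem_insert_iff, Set.mem_singleton_iff] at hx hy hv hxv hyv
    grind
  subst this
  exact Reachable.refl _

lemma BlockPred.exists_block {V : Type*} [Fintype V] {G : SimpleGraph V} {C : Set V}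
    (h : BlockPred G C) : ∃ B, C ⊆ B ∧ IsBlock G B := by
  obtain ⟨B, hCB, hB⟩ := (Set.toFinite {B : Set V | BlockPred G B}).exists_le_maximal h
  exact ⟨B, hCB, hB.1, fun B' h1 h2 => (hB.2 h2 h1).antisymm h1⟩

lemma percIter_mono {V : Type*} (G : SimpleGraph V) (r : ℕ) (A : Set V) :
    Monotone (percIter G r A) :=
  monotone_nat_of_le_succ fun _ => Set.subset_union_left

lemma infect {V : Type*} [Fintype V] {G : SimpleGraph V} {A : Set V} {a b z : V}
    (hab : a ≠ b) (ha : ∃ t, a ∈ percIter G 2 A t) (hb : ∃ t, b ∈ percIter G 2 A t)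
    (hza : G.Adj z a) (hzb : G.Adj z b) : ∃ t, z ∈ percIter G 2 A t := by
  obtain ⟨s, hs⟩ := ha
  obtain ⟨t, ht⟩ := hb
  refine ⟨max s t + 1, Or.inr ?_⟩
  have hs' := percIter_mono G 2 A (le_max_left s t) hs
  have ht' := percIter_mono G 2 A (le_max_right s t) ht
  show 2 ≤ (G.neighborSet z ∩ percIter G 2 A (max s t)).ncard
  refine (Set.ncard_pair hab).symm.le.trans ?_
  apply Set.ncard_le_ncard _ (Set.toFinite _)
  rintro x (rfl | rfl)
  · exact ⟨hza, hs'⟩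
  · exact ⟨hzb, ht'⟩

lemma percolates_of_all {V : Type*} [Fintype V] {G : SimpleGraph V} {A : Set V}
    (h : ∀ z, ∃ t, z ∈ percIter G 2 A t) : Percolates G 2 A := by
  choose f hf using h
  exact ⟨Finset.univ.sup f, Set.eq_univ_of_forall fun z =>
    percIter_mono G 2 A (Finset.le_sup (Finset.mem_univ z)) (hf z)⟩

lemma spread {V : Type*} [Fintype V] {G : SimpleGraph V} {A S : Set V} {w : V}
    (hw : ∃ t, w ∈ percIter G 2 A t) (hS : ∀ z ∈ S, z ≠ w ∧ G.Adj z w) {x z : ↥S}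
    (hr : (G.induce S).Reachable x z) (hx : ∃ t, x.1 ∈ percIter G 2 A t) :
    ∃ t, z.1 ∈ percIter G 2 A t := by
  obtain ⟨p⟩ := hr
  induction p with
  | nil => exact hx
  | @cons a b c hab p ih =>
    have hab' : G.Adj a.1 b.1 := hab
    exact ih (infect (hS a a.2).1 hx hw hab'.symm (hS b b.2).2)

lemma core {V : Type*} [Fintype V] {G : SimpleGraph V} (hconn : G.Connected)
    (hcard : 3 ≤ Fintype.card V) (hblocks : {B : Set V | IsBlock G B}.ncard = 2)
    (hdiam : G.diam = 2) {B₁ B₂ : Set V} (h₁ : IsBlock G B₁) (h₂ : IsBlock G B₂)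
    (hne : B₁ ≠ B₂) :
    ∃ w, B₁ ∩ B₂ = {w} ∧ (B₁ \ {w}).Nonempty ∧ (B₂ \ {w}).Nonempty ∧
      (∀ z, z ≠ w → G.Adj z w) ∧ (∀ z, z ∈ B₁ ∨ z ∈ B₂) := by
  have hall : ∀ B, IsBlock G B → B = B₁ ∨ B = B₂ := by
    have hs : ({B₁, B₂} : Set (Set V)) = {B : Set V | IsBlock G B} := by
      apply Set.eq_of_subset_of_ncard_le
      · rintro B (rfl | rfl) <;> assumption
      · rw [hblocks, Set.ncard_pair hne]
      · exact Set.toFinite _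
    intro B hB
    have : B ∈ ({B₁, B₂} : Set (Set V)) := hs ▸ hB
    exact this
  have hedge : ∀ a b, G.Adj a b → (a ∈ B₁ ∧ b ∈ B₁) ∨ (a ∈ B₂ ∧ b ∈ B₂) := by
    intro a b hab
    obtain ⟨B, hs, hB⟩ := (blockPred_edge hab).exists_block
    have ha : a ∈ B := hs (by simp)
    have hb : b ∈ B := hs (by simp)
    rcases hall B hB with rfl | rfl
    · exact Or.inl ⟨ha, hb⟩
    · exact Or.inr ⟨ha, hb⟩
  have hnt : Nontrivial V := Fintype.one_lt_card_iff_nontrivial.1 (by omega)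
  have hcover : ∀ z, z ∈ B₁ ∨ z ∈ B₂ := by
    intro z
    obtain ⟨b, hb⟩ := hconn.preconnected.exists_adj_of_nontrivial z
    rcases hedge z b hb with h | h
    · exact Or.inl h.1
    · exact Or.inr h.1
  obtain ⟨u₀, hu₁, hu₂⟩ : ∃ u, u ∈ B₁ ∧ u ∉ B₂ := by
    by_contra! h
    exact hne (h₁.2 B₂ h h₂.1).symm
  obtain ⟨y₀, hy₂, hy₁⟩ : ∃ u, u ∈ B₂ ∧ u ∉ B₁ := by
    by_contra! h
    exact hne (h₂.2 B₁ h h₁.1)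
  have huniq : ∀ p q, p ∈ B₁ ∩ B₂ → q ∈ B₁ ∩ B₂ → p = q := by
    intro p q hp hq
    by_contra hpq
    have hu := h₁.1.union h₂.1 hpq hp hq
    exact hne ((h₁.2 _ Set.subset_union_left hu).symm.trans (h₂.2 _ Set.subset_union_right hu))
  have hmid : ∀ u y, u ∈ B₁ → u ∉ B₂ → y ∈ B₂ → y ∉ B₁ →
      ∃ z, z ∈ B₁ ∩ B₂ ∧ G.Adj u z ∧ G.Adj z y := by
    intro u y a1 a2 b1 b2
    have hd : G.dist u y ≤ 2 := by
      rw [← hdiam]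
      apply dist_le_diam
      exact ediam_ne_top_of_diam_ne_zero (by omega)
    obtain ⟨p, hp⟩ := hconn.exists_walk_length_eq_dist u y
    rw [← hp] at hd
    match p, hd with
    | .nil, _ => exact absurd b1 a2
    | .cons h .nil, _ => rcases hedge _ _ h with h | h <;> tauto
    | .cons (v := z) h (.cons h' .nil), _ =>
      refine ⟨z, ⟨?_, ?_⟩, h, h'⟩
      · rcases hedge _ _ h with h | h <;> tauto
      · rcases hedge _ _ h' with h | h <;> tauto
    | .cons _ (.cons _ (.cons _ _)), hd => simp at hd
  obtain ⟨w, hw, huw, hwy⟩ := hmid u₀ y₀ hu₁ hu₂ hy₂ hy₁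
  refine ⟨w, Set.eq_singleton_iff_unique_mem.2 ⟨hw, fun x hx => huniq x w hx hw⟩,
    ⟨u₀, hu₁, huw.ne⟩, ⟨y₀, hy₂, hwy.ne'⟩, ?_, hcover⟩
  intro z hz
  by_cases hz1 : z ∈ B₁
  · have hz2 : z ∉ B₂ := fun h => hz (huniq z w ⟨hz1, h⟩ hw)
    obtain ⟨w', hw', h, _⟩ := hmid z y₀ hz1 hz2 hy₂ hy₁
    exact huniq w' w hw' hw ▸ h
  · have hz2 := (hcover z).resolve_left hz1
    obtain ⟨w', hw', _, h⟩ := hmid u₀ z hu₁ hu₂ hz2 hz1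
    exact huniq w' w hw' hw ▸ h.symm

lemma perc {V : Type*} [Fintype V] {G : SimpleGraph V} {B₁ B₂ : Set V} {w : V}
    (h₁ : IsBlock G B₁) (h₂ : IsBlock G B₂) (hi : B₁ ∩ B₂ = {w})
    (hadj : ∀ z, z ≠ w → G.Adj z w) (hc : ∀ z, z ∈ B₁ ∨ z ∈ B₂)
    {x y : V} (hx : x ∈ B₁ \ {w}) (hy : y ∈ B₂ \ {w}) : x ≠ y ∧ Percolates G 2 {x, y} := by
  have hxy : x ≠ y := by
    rintro rfl
    have : x ∈ B₁ ∩ B₂ := ⟨hx.1, hy.1⟩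
    rw [hi] at this
    exact hx.2 this
  refine ⟨hxy, percolates_of_all fun z => ?_⟩
  have ix : ∃ t, x ∈ percIter G 2 {x, y} t := ⟨0, Or.inl rfl⟩
  have iy : ∃ t, y ∈ percIter G 2 {x, y} t := ⟨0, Or.inr rfl⟩
  have iw := infect hxy ix iy (hadj x hx.2).symm (hadj y hy.2).symm
  by_cases hz : z = w
  · exact hz ▸ iw
  · rcases hc z with h | h
    · exact spread iw (fun z hz => ⟨hz.2, hadj z hz.2⟩) (h₁.1.reach w ⟨x, hx⟩ ⟨z, h, hz⟩) ix
    · exact spread iw (fun z hz => ⟨hz.2, hadj z hz.2⟩) (h₂.1.reach w ⟨y, hy⟩ ⟨z, h, hz⟩) iy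

/-- A finite connected graph of order at least 3 with exactly two blocks and diameter 2
is 2-bootstrap good; moreover, for the cut vertex `v` and the two blocks `B₁, B₂`, any
pair of vertices with one vertex in `B₁ - v` and the other in `B₂ - v` percolates. -/
theorem stmt_2 {V : Type*} [Fintype V] (G : SimpleGraph V)
    (hconn : G.Connected) (hcard : 3 ≤ Fintype.card V)
    (hblocks : {B : Set V | IsBlock G B}.ncard = 2)
    (hdiam : G.diam = 2) :
    BootstrapGood G 2 ∧
      ∀ v : V, IsCutVertex G v →
        ∀ B₁ B₂ : Set V, IsBlock G B₁ → IsBlock G B₂ → B₁ ≠ B₂ →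
          ∀ x ∈ B₁ \ {v}, ∀ y ∈ B₂ \ {v}, Percolates G 2 {x, y} := by
  constructor
  · obtain ⟨B₁, B₂, hne, hB⟩ := Set.ncard_eq_two.1 hblocks
    have h₁ : IsBlock G B₁ := by
      have : B₁ ∈ {B : Set V | IsBlock G B} := by rw [hB]; simp
      exact this
    have h₂ : IsBlock G B₂ := by
      have : B₂ ∈ {B : Set V | IsBlock G B} := by rw [hB]; simp
      exact this
    obtain ⟨w, hi, ⟨x, hx⟩, ⟨y, hy⟩, hadj, hc⟩ := core hconn hcard hblocks hdiam h₁ h₂ hne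
    obtain ⟨hxy, hp⟩ := perc h₁ h₂ hi hadj hc hx hy
    exact ⟨{x, y}, Set.ncard_pair hxy, hp⟩
  · intro v hv B₁ B₂ h₁ h₂ hne x hx y hy
    obtain ⟨w, hi, -, -, hadj, hc⟩ := core hconn hcard hblocks hdiam h₁ h₂ hne
    obtain rfl : v = w := by
      by_contra hvw
      apply hv
      have key : ∀ a : ↥{u | u ≠ v}, (G.induce {u | u ≠ v}).Reachable a ⟨w, Ne.symm hvw⟩ := by
        rintro ⟨a, ha⟩
        by_cases haw : a = w
        · subst haw
          exact Reachable.refl _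
        · exact Adj.reachable (show G.Adj a w from hadj a haw)
      exact (connected_iff_exists_forall_reachable _).2 ⟨⟨w, Ne.symm hvw⟩, fun a => (key a).symm⟩
    exact (perc h₁ h₂ hi hadj hc hx hy).2
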